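/- arXiv:1304.6328 — 3 statements merged into one kernel-verified Lean document; each statement's English description precedes it below -/
import Mathlib

section
/- Let C be a free abelian group and let Ĉ = ℤ × ∏_{i=1}^∞ C^{⊗i}, where C^{⊗i} denotes the i-fold tensor power of C over ℤ. Let e : C → Ĉ be the function sending c ∈ C to the element whose ℤ-component is 1 and whose i-th tensor component is the i-fold tensor c ⊗ c ⊗ ⋯ ⊗ c. Then for any integer t > 1 and any set {c₁, …, c_t} of pairwise distinct, nonzero elements of C, the images 1 ⊗ e(c₁), …, 1 ⊗ e(c_t) in ℚ ⊗_ℤ Ĉ are linearly independent over ℚ. -/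
open scoped TensorProduct

/-- Finitely many distinct elements of a free abelian group are separated by a single
homomorphism to `ℚ`. -/
theorem exists_linearMap_rat_comp_injective
    {C : Type*} [AddCommGroup C] [Module ℤ C] [Module.Free ℤ C]
    {ι : Type*} [Finite ι] {c : ι → C} (hc : Function.Injective c) :
    ∃ f : C →ₗ[ℤ] ℚ, Function.Injective (f ∘ c) := by
  let b := Module.Free.chooseBasis ℤ C
  let g : C →ₗ[ℤ] (Module.Free.ChooseBasisIndex ℤ C →₀ ℚ) :=
    Finsupp.mapRange.linearMap (Algebra.linearMap ℤ ℚ) ∘ₗ b.repr.toLinearMap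
  have hg : Function.Injective g :=
    (Finsupp.mapRange_injective _ (map_zero _) Int.cast_injective).comp b.repr.injective
  obtain ⟨φ, hφ⟩ := Module.exists_dual_forall_apply_ne_zero (K := ℚ)
    (fun p : {p : ι × ι // p.1 ≠ p.2} => g (c p.1.1) - g (c p.1.2))
    fun p => sub_ne_zero.2 fun h => p.2 (hc (hg h))
  refine ⟨φ.restrictScalars ℤ ∘ₗ g, fun i j hij => ?_⟩
  by_contra hne
  refine hφ ⟨(i, j), hne⟩ ?_
  rw [map_sub]
  exact sub_eq_zero.2 hij

/-- The linear functional on a tensor power of `C` induced by `f : C → R`, sending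
`c₁ ⊗ ⋯ ⊗ cₙ` to `f c₁ ⋯ f cₙ`, takes the value `f c ^ n` on a diagonal tensor. -/
theorem lift_mkPiAlgebra_tprod_diagonal {R C A : Type*} [CommSemiring R] [AddCommMonoid C]
    [Module R C] [CommSemiring A] [Algebra R A] (f : C →ₗ[R] A) (n : ℕ) (x : C) :
    PiTensorProduct.lift ((MultilinearMap.mkPiAlgebra R (Fin n) A).compLinearMap fun _ => f)
      (PiTensorProduct.tprod R fun _ => x) = f x ^ n := by
  simp

/-- Lemma (diagonals linearly independent, rational version):
`C` a free abelian group, `Ĉ = ℤ × ∏_{i=1}^∞ C^{⊗i}`, `e c = (1, c, c⊗c, …)`.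
For `t > 1` distinct nonzero `c₁,…,c_t ∈ C`, the images `1 ⊗ e(cⱼ)` in
`ℚ ⊗_ℤ Ĉ` are linearly independent over `ℚ`. -/
theorem diagonals_linearly_independent_rat
    (C : Type) [AddCommGroup C] [Module ℤ C] [Module.Free ℤ C]
    (t : ℕ) (ht : 1 < t) (c : Fin t → C)
    (hdist : Function.Injective c) (hne : ∀ j, c j ≠ 0) :
    LinearIndependent ℚ (fun j : Fin t =>
      ((1 : ℚ) ⊗ₜ[ℤ]
        (((1 : ℤ), fun i : ℕ => (PiTensorProduct.tprod ℤ fun _ : Fin (i + 1) => c j)) :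
          ℤ × ((i : ℕ) → ⨂[ℤ]^(i + 1) C)) :
        ℚ ⊗[ℤ] (ℤ × ((i : ℕ) → ⨂[ℤ]^(i + 1) C)))) := by
  obtain ⟨f, hf⟩ := exists_linearMap_rat_comp_injective hdist
  let coord : ℕ → (ℤ × ((i : ℕ) → ⨂[ℤ]^(i + 1) C)) →ₗ[ℤ] ℚ
    | 0 => Algebra.linearMap ℤ ℚ ∘ₗ LinearMap.fst ℤ _ _
    | i + 1 => PiTensorProduct.lift
        ((MultilinearMap.mkPiAlgebra ℤ (Fin (i + 1)) ℚ).compLinearMap fun _ => f) ∘ₗ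
          LinearMap.proj i ∘ₗ LinearMap.snd ℤ _ _
  have coord_diagonal (k : ℕ) (x : C) :
      coord k (1, fun i => PiTensorProduct.tprod ℤ fun _ : Fin (i + 1) => x) = f x ^ k := by
    cases k with
    | zero => simp [coord]
    | succ i => exact lift_mkPiAlgebra_tprod_diagonal f (i + 1) x
  let Φ := LinearMap.liftBaseChange ℚ (LinearMap.pi fun k : Fin t => coord k)
  have hΦ : (fun j => Φ ((1 : ℚ) ⊗ₜ[ℤ]
      (1, fun i => PiTensorProduct.tprod ℤ fun _ : Fin (i + 1) => c j))) =
      fun j => Matrix.vandermonde (f ∘ c) j := by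
    funext j k
    simp [Φ, coord_diagonal, Matrix.vandermonde_apply]
  refine LinearIndependent.of_comp Φ ?_
  simp only [Function.comp_def]
  rw [hΦ]
  exact Matrix.linearIndependent_rows_of_det_ne_zero (Matrix.det_vandermonde_ne_zero_iff.2 hf)
end

section
/- Let C be a free abelian group and let Ĉ = ℤ × ∏_{i=1}^∞ C^{⊗i}, where C^{⊗i} denotes the i-fold tensor power of C over ℤ. Let e : C → Ĉ be the function sending c ∈ C to the element whose ℤ-component is 1 and whose i-th tensor component is the i-fold tensor c ⊗ c ⊗ ⋯ ⊗ c. Then the ℤ-linear extension ē : ℤ[C] → Ĉ of e, defined on the free abelian group ℤ[C] generated by the underlying set of C, is injective. Equivalently, the family (e(c))_{c ∈ C} is linearly independent over ℤ in Ĉ. -/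
open scoped TensorProduct

/-- The additive extension of a `ℤ`-linearly independent family to the free abelian group on its
index set is injective. -/
theorem FreeAbelianGroup.lift_injective_of_linearIndependent {α M : Type*} [AddCommGroup M]
    {v : α → M} (hv : LinearIndependent ℤ v) :
    Function.Injective (FreeAbelianGroup.lift v) := by
  have h : FreeAbelianGroup.lift v =
      (Finsupp.linearCombination ℤ v).toAddMonoidHom.comp FreeAbelianGroup.toFinsupp := by
    ext x
    simp
  rw [h]
  exact (show Function.Injective _ from hv).comp (FreeAbelianGroup.equivFinsupp α).injective

/-- The sequences of powers of distinct elements of a domain of characteristic zero are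
linearly independent over `ℤ`. -/
theorem linearIndependent_int_pow {α R : Type*} [CommRing R] [IsDomain R] [CharZero R]
    {f : α → R} (hf : Function.Injective f) :
    LinearIndependent ℤ fun (a : α) (n : ℕ) => f a ^ n := by
  have h : LinearIndependent R fun (a : α) (n : ℕ) => f a ^ n := (linearIndependent_monoidHom (Multiplicative ℕ) R).comp
    (fun a => powersHom R (f a)) ((powersHom R).injective.comp hf)
  exact h.restrict_scalars (R := ℤ) fun m n hmn => by simpa using hmn

/-- A free abelian group embeds linearly into a polynomial ring over `ℤ`. -/
theorem Module.Free.exists_injective_mvPolynomial (C : Type*) [AddCommGroup C] [Module ℤ C]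
    [Module.Free ℤ C] :
    ∃ φ : C →ₗ[ℤ] MvPolynomial (Module.Free.ChooseBasisIndex ℤ C) ℤ, Function.Injective φ := by
  refine ⟨(Finsupp.linearCombination ℤ MvPolynomial.X).comp
    (Module.Free.chooseBasis ℤ C).repr.toLinearMap, ?_⟩
  exact (show Function.Injective _ from MvPolynomial.linearIndependent_X _ ℤ).comp
    (Module.Free.chooseBasis ℤ C).repr.injective

/-- The additive map sending `(k, t₁, t₂, …)` to the sequence whose zeroth term is `k` and whose
`n`-th term is the product of the values of `φ` on the factors of `tₙ`. -/
noncomputable def tensorPowersToSequences {C R : Type*} [AddCommGroup C] [Module ℤ C] [CommRing R]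
    (φ : C →ₗ[ℤ] R) : ℤ × ((i : ℕ) → ⨂[ℤ]^(i + 1) C) →+ (ℕ → R) :=
  AddMonoidHom.pi fun n => match n with
    | 0 => (Int.castAddHom R).comp (AddMonoidHom.fst _ _)
    | i + 1 => (PiTensorProduct.lift ((MultilinearMap.mkPiAlgebra ℤ (Fin (i + 1)) R).compLinearMap
        fun _ => φ)).toAddMonoidHom.comp ((Pi.evalAddMonoidHom _ i).comp (AddMonoidHom.snd _ _))

theorem tensorPowersToSequences_diagonal {C R : Type*} [AddCommGroup C] [Module ℤ C] [CommRing R]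
    (φ : C →ₗ[ℤ] R) (c : C) :
    tensorPowersToSequences φ (1, fun i => PiTensorProduct.tprod ℤ fun _ : Fin (i + 1) => c) =
      fun n => φ c ^ n := by
  funext n
  cases n with
  | zero =>
    trans ((1 : ℤ) : R)
    · rfl
    · simp
  | succ i =>
    trans PiTensorProduct.lift ((MultilinearMap.mkPiAlgebra ℤ (Fin (i + 1)) R).compLinearMap
      fun _ => φ) (PiTensorProduct.tprod ℤ fun _ => c)
    · rfl
    · simp

/-- Lemma: `C` a free abelian group, `Ĉ = ℤ × ∏_{i=1}^∞ C^{⊗i}`,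
`e : C → Ĉ`, `e c = (1, c, c⊗c, …)`.  The ℤ-linear extension
`ē : ℤ[C] → Ĉ` of `e` on the free abelian group generated by the
underlying set of `C` is injective. -/
theorem linear_extension_of_diagonal_injective
    (C : Type) [AddCommGroup C] [Module ℤ C] [Module.Free ℤ C] :
    Function.Injective
      (⇑(FreeAbelianGroup.lift (fun c : C =>
        (((1 : ℤ), fun i : ℕ => (PiTensorProduct.tprod ℤ fun _ : Fin (i + 1) => c)) :
          ℤ × ((i : ℕ) → ⨂[ℤ]^(i + 1) C))))) := by
  obtain ⟨φ, hφ⟩ := Module.Free.exists_injective_mvPolynomial C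
  refine Function.Injective.of_comp (f := tensorPowersToSequences φ) ?_
  rw [← AddMonoidHom.coe_comp]
  convert FreeAbelianGroup.lift_injective_of_linearIndependent (linearIndependent_int_pow hφ)
    using 2
  ext c : 1
  simp [tensorPowersToSequences_diagonal]
end

section
/- Let ℓ₁, …, ℓ_t (t > 1) be pairwise distinct nonzero homogeneous polynomials of degree 1 (linear forms) in the polynomial ring ℚ[X₁, X₂, …] in countably many indeterminates over ℚ. Then the t polynomials p_i = 1 + ℓ_i + ℓ_i² + ⋯ + ℓ_i^{t−1} (i = 1, …, t) are linearly independent over ℚ. Equivalently, if α₁, …, α_t ∈ ℚ satisfy Σ_{i=1}^t α_i · p_i = 0, then α₁ = ⋯ = α_t = 0. -/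
/-- Let `ℓ₁,…,ℓ_t` (`t > 1`) be pairwise distinct nonzero homogeneous
polynomials of degree 1 in `ℚ[X₁, X₂, …]` (countably many indeterminates).
Then the polynomials `p_i = 1 + ℓ_i + ℓ_i² + ⋯ + ℓ_i^{t-1}` are linearly
independent over `ℚ`. -/
theorem geometric_sums_of_distinct_linear_forms_linearly_independent
    (t : ℕ) (ht : 1 < t) (ℓ : Fin t → MvPolynomial ℕ ℚ)
    (hhom : ∀ i, (ℓ i).IsHomogeneous 1) (hne : ∀ i, ℓ i ≠ 0)
    (hdist : Function.Injective ℓ) :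
    LinearIndependent ℚ (fun i : Fin t => ∑ j ∈ Finset.range t, ℓ i ^ j) := by
  rw [Fintype.linearIndependent_iff]
  intro g hg
  suffices h : (fun i => MvPolynomial.C (g i) : Fin t → MvPolynomial ℕ ℚ) = 0 from
    fun i => MvPolynomial.C_eq_zero.mp (congrFun h i)
  refine Matrix.eq_zero_of_forall_pow_sum_mul_pow_eq_zero hdist fun k => ?_
  have hpow (i : Fin t) (j : ℕ) :
      MvPolynomial.homogeneousComponent (k : ℕ) (ℓ i ^ j) = if (k : ℕ) = j then ℓ i ^ j else 0 :=
    MvPolynomial.homogeneousComponent_of_mem (by simpa using (hhom i).pow j)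
  have hcomp := congrArg (MvPolynomial.homogeneousComponent (k : ℕ)) hg
  simpa [map_sum, hpow, MvPolynomial.smul_eq_C_mul] using hcomp
end
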